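/- Let U, D(α), θ, z(·) and F_k be as in the context. Fix α, k, k', k'', p ∈ ℂ and let u : ℂ → ℂ² be smooth with u(z+γ) = e^{i⟨p,γ⟩}·(e^{−i⟨γ,K⟩}u₁(z), e^{i⟨γ,K⟩}u₂(z)) for all γ ∈ Λ, satisfying D(α)u + k·u = 0 on ℂ, and u(z(k'')) = 0. Define v(z) := F_{k'}(z − z(k''))·u(z) for z ∉ z(k'') + Λ. Then: (i) D(α)v + (k + k')·v = 0 on ℂ ∖ (z(k'') + Λ); (ii) v(z+γ) = e^{i⟨p,γ⟩}·(e^{−i⟨γ,K⟩}v₁(z), e^{i⟨γ,K⟩}v₂(z)) for all γ ∈ Λ and z ∉ z(k'') + Λ; (iii) v is bounded on D(w, 1/2) ∖ {w} for each w ∈ z(k'') + Λ. -/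

import Mathlib

noncomputable section

open Complex ComplexConjugate

/-- ω = exp(2πi/3). -/
def ω : ℂ := Complex.exp (2 * Real.pi * Complex.I / 3)

/-- The lattice Λ = ℤ + ωℤ. -/
def Lam : Set ℂ := {z : ℂ | ∃ m n : ℤ, z = (m : ℂ) + (n : ℂ) * ω}

/-- The dual lattice Λ* = (4πi/√3)Λ. -/
def LamS : Set ℂ :=
  {z : ℂ | ∃ m n : ℤ,
    z = 4 * (Real.pi : ℂ) * Complex.I / (Real.sqrt 3 : ℂ) * ((m : ℂ) + (n : ℂ) * ω)}

/-- ⟨z,w⟩ = Re (z ⬝ conj w). -/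
def pairing (z w : ℂ) : ℝ := (z * conj w).re

/-- K = 4π/3. -/
def Kpt : ℂ := 4 * (Real.pi : ℂ) / 3

/-- 2D_z̄ u = −i(∂ₓu + i∂9u), via the real Fréchet derivative. -/
def twoDbar (u : ℂ → ℂ) (z : ℂ) : ℂ :=
  -Complex.I * (fderiv ℝ u z 1 + Complex.I * fderiv ℝ u z Complex.I)

/-- The magnetic chiral Dirac operator D_B(α). -/
def DB (U : ℂ → ℂ) (α B : ℂ) (u : ℂ → ℂ × ℂ) (z : ℂ) : ℂ × ℂ :=
  (twoDbar (fun w => (u w).1) z + α * U z * (u z).2 + B * (u z).1,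
   α * U (-z) * (u z).1 + twoDbar (fun w => (u w).2) z - B * (u z).2)

/-- The chiral Dirac operator D(α) (no magnetic field). -/
def Dop (U : ℂ → ℂ) (α : ℂ) (u : ℂ → ℂ × ℂ) (z : ℂ) : ℂ × ℂ :=
  (twoDbar (fun w => (u w).1) z + α * U z * (u z).2,
   α * U (-z) * (u z).1 + twoDbar (fun w => (u w).2) z)

/-- The L²₀ boundary condition. -/
def BC (u : ℂ → ℂ × ℂ) : Prop :=
  ∀ γ ∈ Lam, ∀ z : ℂ,
    u (z + γ) = (Complex.exp (-Complex.I * (pairing γ Kpt : ℂ)) * (u z).1,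
                 Complex.exp (Complex.I * (pairing γ Kpt : ℂ)) * (u z).2)

/-- Hypotheses on the potential U. -/
def IsPotential (U : ℂ → ℂ) : Prop :=
  ContDiff ℝ (⊤ : ℕ∞) U ∧
  (∀ γ ∈ Lam, ∀ z : ℂ,
    U (z + γ) = Complex.exp (-2 * Complex.I * (pairing γ Kpt : ℂ)) * U z) ∧
  (∀ z : ℂ, U (ω * z) = ω * U z) ∧
  (∀ z : ℂ, conj (U (conj z)) = - U (-z))

/-- The Jacobi theta function θ(z) = θ₁(z|ω) = −θ_{1/2,1/2}(z|ω). -/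
def θf (z : ℂ) : ℂ :=
  -∑' n : ℤ, Complex.exp ((Real.pi : ℂ) * Complex.I * ((n : ℂ) + 1/2)^2 * ω
      + 2 * (Real.pi : ℂ) * Complex.I * ((n : ℂ) + 1/2) * (z + 1/2))

/-- z(k) = √3 k / (4πi). -/
def zpt (k : ℂ) : ℂ := (Real.sqrt 3 : ℂ) * k / (4 * (Real.pi : ℂ) * Complex.I)

/-- F_k(z) = e^{(i/2)(z − z̄)k} θ(z − z(k)) / θ(z). -/
def Fk (k z : ℂ) : ℂ :=
  Complex.exp (Complex.I / 2 * (z - conj z) * k) * θf (z - zpt k) / θf z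


lemma omega_re : ω.re = -1/2 := by
  have : ω = Complex.exp (((2 * Real.pi / 3 : ℝ) : ℂ) * Complex.I) := by
    unfold ω; congr 1; push_cast; ring
  rw [this, Complex.exp_ofReal_mul_I_re]
  rw [show 2 * Real.pi / 3 = Real.pi - Real.pi / 3 by ring, Real.cos_pi_sub, Real.cos_pi_div_three]
  norm_num

lemma omega_im : ω.im = Real.sqrt 3 / 2 := by
  have : ω = Complex.exp (((2 * Real.pi / 3 : ℝ) : ℂ) * Complex.I) := by
    unfold ω; congr 1; push_cast; ring
  rw [this, Complex.exp_ofReal_mul_I_im]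
  rw [show 2 * Real.pi / 3 = Real.pi - Real.pi / 3 by ring, Real.sin_pi_sub, Real.sin_pi_div_three]

lemma omega_im_pos : 0 < ω.im := by
  rw [omega_im]; positivity

lemma theta_eq (z : ℂ) : θf z = -(Complex.exp (Real.pi * I * ω / 4 + Real.pi * I * (z + 1/2)) *
    jacobiTheta₂ (z + 1/2 + ω/2) ω) := by
  unfold θf jacobiTheta₂
  rw [← tsum_mul_left]
  congr 1
  apply tsum_congr
  intro n
  unfold jacobiTheta₂_term
  rw [← Complex.exp_add]
  congr 1
  ring

lemma theta_diff : Differentiable ℂ θf := by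
  have : θf = fun z => -(Complex.exp (Real.pi * I * ω / 4 + Real.pi * I * (z + 1/2)) *
    jacobiTheta₂ (z + 1/2 + ω/2) ω) := funext theta_eq
  rw [this]
  intro z
  have h := differentiableAt_jacobiTheta₂_fst (z + 1/2 + ω/2) omega_im_pos
  have h2 : DifferentiableAt ℂ (fun z : ℂ => jacobiTheta₂ (z + 1/2 + ω/2) ω) z :=
    DifferentiableAt.comp z (g := fun z => jacobiTheta₂ z ω) (f := fun z => z + 1/2 + ω/2) h (by fun_prop)
  fun_prop

lemma exp_pi_I' : Complex.exp (Real.pi * I) = -1 := Complex.exp_pi_mul_I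

lemma theta_add_one (z : ℂ) : θf (z + 1) = - θf z := by
  rw [theta_eq, theta_eq, show z + 1 + 1/2 + ω/2 = (z + 1/2 + ω/2) + 1 by ring,
    jacobiTheta₂_add_left,
    show (Real.pi * I * ω / 4 + Real.pi * I * (z + 1 + 1/2) : ℂ) =
      (Real.pi * I * ω / 4 + Real.pi * I * (z + 1/2)) + Real.pi * I by ring, Complex.exp_add _ (Real.pi * I), exp_pi_I']
  ring

lemma theta_add_omega (z : ℂ) : θf (z + ω) =
    - Complex.exp (-Real.pi * I * ω - 2 * Real.pi * I * z) * θf z := by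
  rw [theta_eq, theta_eq, show z + ω + 1/2 + ω/2 = (z + 1/2 + ω/2) + ω by ring,
    jacobiTheta₂_add_left']
  have : Complex.exp (-Real.pi * I * ω - 2 * Real.pi * I * z) =
      - Complex.exp (-Real.pi * I * ω - 2 * Real.pi * I * z - Real.pi * I) := by
    rw [Complex.exp_sub _ (Real.pi * I), exp_pi_I']; ring
  rw [this]
  simp only [neg_neg, mul_neg, neg_inj]
  rw [← mul_assoc, ← mul_assoc, ← Complex.exp_add, ← Complex.exp_add]
  congr 2
  ring

lemma Fk_per_one (k : ℂ) : Function.Periodic (Fk k) 1 := by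
  intro z
  unfold Fk
  rw [show z + 1 - zpt k = z - zpt k + 1 by ring, theta_add_one, theta_add_one]
  simp only [map_add, map_one, mul_neg, neg_div_neg_eq]
  congr 4
  ring

lemma omega_sub_conj : ω - conj ω = Real.sqrt 3 * I := by
  apply Complex.ext
  · simp
  · simp [omega_im]

lemma Fk_per_omega (k : ℂ) : Function.Periodic (Fk k) ω := by
  intro z
  unfold Fk
  rw [show z + ω - zpt k = z - zpt k + ω by ring, theta_add_omega, theta_add_omega]
  have h1 : Complex.exp (I / 2 * (z + ω - conj (z + ω)) * k) *
      Complex.exp (-Real.pi * I * ω - 2 * Real.pi * I * (z - zpt k)) =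
      Complex.exp (I / 2 * (z - conj z) * k) *
        Complex.exp (-Real.pi * I * ω - 2 * Real.pi * I * z) := by
    rw [← Complex.exp_add, ← Complex.exp_add]
    congr 1
    have : z + ω - conj (z + ω) = (z - conj z) + Real.sqrt 3 * I := by
      rw [map_add, ← omega_sub_conj]; ring
    rw [this]
    unfold zpt
    have hpi : (Real.pi : ℂ) ≠ 0 := by exact_mod_cast Real.pi_ne_zero
    field_simp
    ring_nf
    simp
  have h2 := Complex.exp_ne_zero (-Real.pi * I * ω - 2 * Real.pi * I * z)
  rw [show Complex.exp (I / 2 * (z + ω - conj (z + ω)) * k) *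
      (-Complex.exp (-Real.pi * I * ω - 2 * Real.pi * I * (z - zpt k)) * θf (z - zpt k)) =
      (-Complex.exp (-Real.pi * I * ω - 2 * Real.pi * I * z)) *
      (Complex.exp (I / 2 * (z - conj z) * k) * θf (z - zpt k)) by
        linear_combination (-θf (z - zpt k)) * h1]
  rw [mul_div_mul_left _ _ (neg_ne_zero.mpr h2)]

lemma Fk_per (k : ℂ) {γ : ℂ} (hγ : γ ∈ Lam) (z : ℂ) : Fk k (z + γ) = Fk k z := by
  obtain ⟨m, n, rfl⟩ := hγ
  have h1 := (Fk_per_one k).int_mul m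
  have h2 := (Fk_per_omega k).int_mul n
  rw [← add_assoc, h2]
  simpa using h1 z

lemma norm_sin_odd (a : ℂ) (E : ℝ) (hE : ‖Complex.exp (a * I)‖ ≤ E)
    (hE' : ‖Complex.exp (-a * I)‖ ≤ E) (n : ℕ) :
    ‖Complex.sin ((2 * n + 1) * a)‖ ≤ (2 * n + 1) * (E ^ 2) ^ n * ‖Complex.sin a‖ := by
  have hE0 : 0 ≤ E := (norm_nonneg _).trans hE
  induction n with
  | zero => simp
  | succ n ih =>
    have key : Complex.sin ((2 * (n + 1 : ℕ) + 1) * a) =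
        Complex.sin ((2 * n + 1) * a) * Complex.exp (a * I) ^ 2 +
        Complex.exp (-a * I) ^ (2 * n + 1) *
          ((Complex.exp (a * I) + Complex.exp (-a * I)) * Complex.sin a) := by
      have e1 : Complex.exp (a * I) ^ 2 = Complex.exp ((2 * a) * I) := by
        rw [← Complex.exp_nat_mul]; congr 1; push_cast; ring
      have e2 : Complex.exp (-a * I) ^ (2 * n + 1) = Complex.exp (-((2 * n + 1) * a) * I) := by
        rw [← Complex.exp_nat_mul]; congr 1; push_cast; ring
      have e3 : (Complex.exp (a * I) + Complex.exp (-a * I)) * Complex.sin a =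
          Complex.sin (2 * a) := by
        rw [Complex.sin_two_mul, Complex.cos]; ring
      rw [e1, e2, e3, Complex.exp_mul_I, Complex.exp_mul_I, Complex.cos_neg, Complex.sin_neg,
        show (2 * (n + 1 : ℕ) + 1) * a = (2 * n + 1) * a + 2 * a by push_cast; ring,
        Complex.sin_add]
      ring
    rw [key]
    refine (norm_add_le _ _).trans ?_
    rw [norm_mul, norm_mul, norm_mul, norm_pow, norm_pow]
    have h2 : ‖Complex.exp (a * I) + Complex.exp (-a * I)‖ ≤ 2 * E :=
      (norm_add_le _ _).trans (by linarith)
    calc _ ≤ ((2 * n + 1) * (E ^ 2) ^ n * ‖Complex.sin a‖) * E ^ 2 +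
          E ^ (2 * n + 1) * ((2 * E) * ‖Complex.sin a‖) := by gcongr
      _ = _ := by push_cast; ring

/-- sine expansion of theta -/
lemma theta_hasSum (z : ℂ) : HasSum (fun n : ℕ =>
    2 * Complex.exp (Real.pi * I * (n + 1/2)^2 * ω) * (-1)^n * Complex.sin ((2 * n + 1) * (Real.pi * z)))
    (θf z) := by
  have hs : Summable (fun n : ℤ => Complex.exp ((Real.pi : ℂ) * Complex.I * ((n : ℂ) + 1/2)^2 * ω
      + 2 * (Real.pi : ℂ) * Complex.I * ((n : ℂ) + 1/2) * (z + 1/2))) := by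
    have := ((summable_jacobiTheta₂_term_iff (z + 1/2 + ω/2) ω).mpr omega_im_pos).mul_left
      (Complex.exp (Real.pi * I * ω / 4 + Real.pi * I * (z + 1/2)))
    refine this.congr ?_
    intro n
    unfold jacobiTheta₂_term
    rw [← Complex.exp_add]
    congr 1
    ring
  have h := hs.hasSum.nat_add_neg_add_one.neg
  have e : (fun n : ℕ =>
    2 * Complex.exp (Real.pi * I * (n + 1/2)^2 * ω) * (-1)^n * Complex.sin ((2 * n + 1) * (Real.pi * z))) =
    fun n : ℕ => -(Complex.exp ((Real.pi : ℂ) * Complex.I * (((n : ℤ) : ℂ) + 1/2)^2 * ω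
      + 2 * (Real.pi : ℂ) * Complex.I * (((n : ℤ) : ℂ) + 1/2) * (z + 1/2)) +
      Complex.exp ((Real.pi : ℂ) * Complex.I * (((-((n : ℤ) + 1) : ℤ) : ℂ) + 1/2)^2 * ω
      + 2 * (Real.pi : ℂ) * Complex.I * (((-((n : ℤ) + 1) : ℤ) : ℂ) + 1/2) * (z + 1/2))) := by
    funext n
    have hI : Complex.exp (Real.pi / 2 * I) = I := Complex.exp_pi_div_two_mul_I
    have hp : Complex.exp ((2 * n + 1) * (Real.pi / 2 * I)) = (-1)^n * I := by
      rw [show (2 * (n : ℂ) + 1) = ((2 * n + 1 : ℕ) : ℂ) by push_cast; ring, Complex.exp_nat_mul, hI,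
        pow_succ, pow_mul, I_sq]
    have hm : Complex.exp (-((2 * n + 1) * (Real.pi / 2 * I))) = -((-1)^n * I) := by
      rw [Complex.exp_neg, hp, mul_inv, inv_I]
      rcases neg_one_pow_eq_or ℂ n with h | h <;> rw [h] <;> norm_num
    push_cast
    rw [show ((Real.pi : ℂ) * Complex.I * ((n : ℂ) + 1/2)^2 * ω
      + 2 * (Real.pi : ℂ) * Complex.I * ((n : ℂ) + 1/2) * (z + 1/2)) =
      Real.pi * I * (n + 1/2)^2 * ω + ((2 * n + 1) * (Real.pi * z) * I + (2 * n + 1) * (Real.pi / 2 * I)) by ring,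
      show ((Real.pi : ℂ) * Complex.I * (-((n : ℂ) + 1) + 1/2)^2 * ω
      + 2 * (Real.pi : ℂ) * Complex.I * (-((n : ℂ) + 1) + 1/2) * (z + 1/2)) =
      Real.pi * I * (n + 1/2)^2 * ω + (-((2 * n + 1) * (Real.pi * z)) * I + -((2 * n + 1) * (Real.pi / 2 * I))) by ring]
    simp only [Complex.exp_add]
    rw [hp, hm, Complex.sin]
    ring
  rw [e]
  exact h

lemma term_norm (n : ℕ) : ‖Complex.exp (Real.pi * I * (n + 1/2)^2 * ω)‖ =
    Real.exp (-(Real.pi * (n + 1/2)^2 * (Real.sqrt 3 / 2))) := by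
  rw [Complex.norm_exp]
  congr 1
  have : (Real.pi * I * ((n : ℂ) + 1/2)^2 * ω) = ((Real.pi * (n + 1/2)^2 : ℝ) : ℂ) * (I * ω) := by
    push_cast; ring
  rw [this, Complex.re_ofReal_mul]
  simp [omega_im]

lemma sqrt3_ge : (1.7 : ℝ) ≤ Real.sqrt 3 := Real.le_sqrt_of_sq_le (by norm_num)

lemma exp_neg_two_le : Real.exp (-2) ≤ 1/5 := by
  have h : (2.7182818283 : ℝ) < Real.exp 1 := Real.exp_one_gt_d9
  have : Real.exp (-2) = (Real.exp 1)⁻¹ ^ 2 := by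
    rw [← Real.exp_neg, ← Real.exp_nat_mul]; norm_num
  rw [this, inv_pow, one_div]
  apply inv_anti₀ (by norm_num)
  nlinarith

lemma coef_bound (n : ℕ) : Real.exp (-(Real.pi * (n + 1/2)^2 * (Real.sqrt 3 / 2))) *
    (Real.exp (Real.pi / 2) ^ 2) ^ n ≤
    Real.exp (-(Real.pi * (Real.sqrt 3 / 8))) * (1/5) ^ n := by
  have h5 : Real.exp (-2) ^ n ≤ (1/5) ^ n :=
    pow_le_pow_left₀ (Real.exp_pos _).le exp_neg_two_le n
  refine le_trans ?_ (mul_le_mul_of_nonneg_left h5 (Real.exp_pos _).le)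
  rw [← pow_mul, ← Real.exp_nat_mul, ← Real.exp_nat_mul, ← Real.exp_add, ← Real.exp_add]
  apply Real.exp_le_exp.mpr
  push_cast
  have hn : (n : ℝ) ≤ n * n := by exact_mod_cast Nat.le_mul_self n
  have hn0 : (0 : ℝ) ≤ n := Nat.cast_nonneg n
  have h3 := sqrt3_ge
  have hpi := Real.pi_gt_three
  have hq : 3 * 1.7 * (n : ℝ) - 3 * n ≤ Real.pi * (Real.sqrt 3 * n - n) := by
    have : 0 ≤ (Real.sqrt 3 - 1.7) * n := mul_nonneg (by linarith) hn0
    nlinarith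
  have hq2 : 0 ≤ Real.pi * (Real.sqrt 3 * (n * n - n)) :=
    mul_nonneg Real.pi_pos.le (mul_nonneg (by linarith) (by linarith))
  nlinarith

lemma theta_lower (z : ℂ) (hz : |z.im| ≤ 1/2) :
    Real.exp (-(Real.pi * (Real.sqrt 3 / 8))) / 4 * ‖Complex.sin (Real.pi * z)‖ ≤ ‖θf z‖ := by
  set A := Real.exp (-(Real.pi * (Real.sqrt 3 / 8))) with hA
  have hA0 : 0 < A := Real.exp_pos _
  set s := ‖Complex.sin (Real.pi * z)‖ with hs
  have h := theta_hasSum z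
  obtain ⟨hz1, hz2⟩ := abs_le.mp hz
  have hE : ‖Complex.exp (Real.pi * z * I)‖ ≤ Real.exp (Real.pi / 2) := by
    rw [Complex.norm_exp]; apply Real.exp_le_exp.mpr
    simp
    nlinarith [Real.pi_pos]
  have hE' : ‖Complex.exp (-(Real.pi * z) * I)‖ ≤ Real.exp (Real.pi / 2) := by
    rw [Complex.norm_exp]; apply Real.exp_le_exp.mpr
    simp
    nlinarith [Real.pi_pos]
  have h1 := (hasSum_nat_add_iff' 1).mpr h
  have hterm : ∀ n : ℕ, ‖2 * Complex.exp (Real.pi * I * (n + 1/2)^2 * ω) * (-1)^n *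
      Complex.sin ((2 * n + 1) * (Real.pi * z))‖ ≤ 2 * A * s * ((2 * n + 1) * (1/5)^n) := by
    intro n
    rw [norm_mul, norm_mul, norm_mul, term_norm, norm_pow, norm_neg, norm_one, one_pow,
      Complex.norm_ofNat, mul_one]
    have ha := norm_sin_odd _ _ hE hE' n
    have hb := coef_bound n
    have hpos : 0 ≤ (2 * (n : ℝ) + 1) * s := by positivity
    calc _ ≤ 2 * Real.exp (-(Real.pi * (n + 1/2)^2 * (Real.sqrt 3 / 2))) *
          ((2 * n + 1) * (Real.exp (Real.pi / 2) ^ 2) ^ n * s) := by gcongr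
      _ = 2 * (((2 * n + 1) * s) * (Real.exp (-(Real.pi * (n + 1/2)^2 * (Real.sqrt 3 / 2))) *
          (Real.exp (Real.pi / 2) ^ 2) ^ n)) := by ring
      _ ≤ 2 * (((2 * n + 1) * s) * (A * (1/5) ^ n)) := by gcongr
      _ = _ := by ring
  have hg : HasSum (fun n : ℕ => (2 * (n : ℝ) + 1) * (1/5 : ℝ)^n) (15/8) := by
    have g1 := hasSum_coe_mul_geometric_of_norm_lt_one (r := (1/5 : ℝ)) (by norm_num)
    have g2 := hasSum_geometric_of_norm_lt_one (ξ := (1/5 : ℝ)) (by norm_num)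
    convert! (g1.mul_left 2).add g2 using 1
    · funext n; ring
    · norm_num
  have hg1 := ((hasSum_nat_add_iff' 1).mpr hg).mul_left (2 * A * s)
  have hb := h1.norm_le_of_bounded hg1 (fun n => by exact_mod_cast hterm (n + 1))
  simp only [Finset.range_one, Finset.sum_singleton] at hb
  have h0 : ‖2 * Complex.exp (Real.pi * I * (((0 : ℕ) : ℂ) + 1/2)^2 * ω) * (-1)^0 *
      Complex.sin ((2 * ((0 : ℕ) : ℂ) + 1) * (Real.pi * z))‖ = 2 * A * s := by
    rw [norm_mul, norm_mul, norm_mul, term_norm]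
    simp [hA, hs]
    left; ring
  have h4 := norm_sub_norm_le (2 * Complex.exp (Real.pi * I * (((0 : ℕ) : ℂ) + 1/2)^2 * ω) * (-1)^0 *
      Complex.sin ((2 * ((0 : ℕ) : ℂ) + 1) * (Real.pi * z))) (θf z)
  rw [norm_sub_rev, h0] at h4
  have h5 := h4.trans hb
  norm_num at h5
  have : 0 ≤ A * s := by positivity
  linarith

lemma theta_zero_per_one : Function.Periodic (fun z => θf z = 0) 1 := by
  intro z
  simp [theta_add_one]

lemma theta_zero_per_omega : Function.Periodic (fun z => θf z = 0) ω := by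
  intro z
  simp [theta_add_omega]

lemma theta_ne_zero {z : ℂ} (hz : z ∉ Lam) : θf z ≠ 0 := by
  intro h0
  apply hz
  have hw := omega_im_pos
  set n : ℤ := round (z.im / ω.im) with hn
  have h1 : θf (z - n * ω) = 0 := by
    have := (theta_zero_per_omega.int_mul n) (z - n * ω)
    simp only [sub_add_cancel] at this
    rw [← this]; exact h0
  have him : |(z - n * ω).im| ≤ 1/2 := by
    have hr := abs_sub_round (z.im / ω.im)
    rw [← hn] at hr
    have e : (z - n * ω).im = (z.im / ω.im - n) * ω.im := by
      simp
      field_simp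
    rw [e, abs_mul, abs_of_pos hw]
    have : ω.im ≤ 1 := by
      rw [omega_im]
      have : Real.sqrt 3 ≤ 2 := Real.sqrt_le_iff.mpr (by norm_num)
      linarith
    nlinarith [abs_nonneg (z.im / ω.im - n)]
  have h2 := theta_lower _ him
  rw [h1, norm_zero] at h2
  have hA := Real.exp_pos (-(Real.pi * (Real.sqrt 3 / 8)))
  have h3 : ‖Complex.sin (Real.pi * (z - n * ω))‖ = 0 := by
    have := norm_nonneg (Complex.sin (Real.pi * (z - n * ω)))
    nlinarith
  rw [norm_eq_zero, Complex.sin_eq_zero_iff] at h3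
  obtain ⟨m, hm⟩ := h3
  refine ⟨m, n, ?_⟩
  have hpi : (Real.pi : ℂ) ≠ 0 := by exact_mod_cast Real.pi_ne_zero
  rw [mul_comm] at hm
  have := mul_right_cancel₀ hpi hm
  linear_combination this

lemma sin_lower (s : ℂ) (hs : ‖s‖ ≤ 1/2) : 2 * ‖s‖ ≤ ‖Complex.sin (Real.pi * s)‖ := by
  have hpi := Real.pi_pos
  have hx : |s.re| ≤ 1/2 := (Complex.abs_re_le_norm s).trans hs
  have h1 : 2 * |s.re| ≤ |Real.sin (Real.pi * s.re)| := by
    have := Real.mul_abs_le_abs_sin (x := Real.pi * s.re) (by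
      rw [abs_mul, abs_of_pos hpi]; nlinarith)
    rw [abs_mul, abs_of_pos hpi] at this
    refine le_trans (le_of_eq ?_) this
    field_simp
  have h2 : 2 * |s.im| ≤ |Real.sinh (Real.pi * s.im)| := by
    rw [Real.abs_sinh, abs_mul, abs_of_pos hpi]
    have : Real.pi * |s.im| ≤ Real.sinh (Real.pi * |s.im|) :=
      Real.self_le_sinh_iff.mpr (by positivity)
    nlinarith [abs_nonneg s.im, Real.pi_gt_three]
  have e : ‖Complex.sin (Real.pi * s)‖ ^ 2 =
      Real.sin (Real.pi * s.re) ^ 2 + Real.sinh (Real.pi * s.im) ^ 2 := by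
    rw [Complex.sq_norm, Complex.sin_eq]
    have r1 : (Real.pi * s).re = Real.pi * s.re := by simp
    have r2 : (Real.pi * s).im = Real.pi * s.im := by simp
    rw [r1, r2, ← Complex.ofReal_sin, ← Complex.ofReal_cos, ← Complex.ofReal_sinh,
      ← Complex.ofReal_cosh, ← Complex.ofReal_mul, ← Complex.ofReal_mul, Complex.normSq_add_mul_I,
      mul_pow, mul_pow, Real.cosh_sq, Real.cos_sq']
    ring
  have g1 := pow_le_pow_left₀ (by positivity) h1 2
  have g2 := pow_le_pow_left₀ (by positivity) h2 2
  rw [mul_pow, sq_abs, sq_abs] at g1 g2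
  refine (abs_le_of_sq_le_sq' ?_ (norm_nonneg _)).2
  rw [e, mul_pow, Complex.sq_norm, Complex.normSq_apply]
  nlinarith

lemma twoDbar_mul {f g : ℂ → ℂ} {z : ℂ} (hf : DifferentiableAt ℝ f z)
    (hg : DifferentiableAt ℝ g z) :
    twoDbar (fun w => f w * g w) z = f z * twoDbar g z + g z * twoDbar f z := by
  unfold twoDbar
  rw [fderiv_fun_mul hf hg]
  simp
  ring

lemma twoDbar_holo {f : ℂ → ℂ} {z : ℂ} (hf : DifferentiableAt ℂ f z) : twoDbar f z = 0 := by
  unfold twoDbar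
  rw [hf.fderiv_restrictScalars ℝ]
  simp only [ContinuousLinearMap.coe_restrictScalars']
  have : fderiv ℂ f z I = I * fderiv ℂ f z 1 := by
    rw [← smul_eq_mul, ← map_smul]; simp
  rw [this, ← mul_assoc, I_mul_I]
  ring

lemma hasFDeriv_E (k c z : ℂ) : HasFDerivAt
    (fun w : ℂ => Complex.exp (I / 2 * ((w - c) - conj (w - c)) * k))
    (Complex.exp (I / 2 * ((z - c) - conj (z - c)) * k) •
      ((I / 2 * k) • (ContinuousLinearMap.id ℝ ℂ - Complex.conjCLE.toContinuousLinearMap))) z := by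
  apply HasFDerivAt.cexp
  have h1 : HasFDerivAt (fun w : ℂ => w - c) (ContinuousLinearMap.id ℝ ℂ) z :=
    (hasFDerivAt_id z).sub_const c
  have h2 : HasFDerivAt (fun w : ℂ => conj (w - c)) (Complex.conjCLE.toContinuousLinearMap) z := by
    have := (Complex.conjCLE.toContinuousLinearMap.hasFDerivAt (x := z - c)).comp z h1
    exact this
  have h3 := (h1.sub h2).const_mul (I / 2 * k)
  refine h3.congr_of_eventuallyEq (Filter.Eventually.of_forall fun w => ?_)
  simp only [Pi.sub_apply]
  ring

lemma Fk_shift_eq (k c : ℂ) : (fun w => Fk k (w - c)) = fun w =>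
    Complex.exp (I / 2 * ((w - c) - conj (w - c)) * k) * (θf (w - c - zpt k) / θf (w - c)) := by
  funext w
  unfold Fk
  rw [mul_div_assoc]

lemma quot_diff (k c z : ℂ) (hz : z - c ∉ Lam) :
    DifferentiableAt ℂ (fun w => θf (w - c - zpt k) / θf (w - c)) z := by
  have h1 : DifferentiableAt ℂ (fun w => θf (w - c - zpt k)) z :=
    theta_diff.differentiableAt.comp z (by fun_prop)
  have h2 : DifferentiableAt ℂ (fun w => θf (w - c)) z :=
    theta_diff.differentiableAt.comp z (by fun_prop)
  exact h1.fun_div h2 (theta_ne_zero hz)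

lemma Fk_shift_diff (k c z : ℂ) (hz : z - c ∉ Lam) :
    DifferentiableAt ℝ (fun w => Fk k (w - c)) z := by
  rw [Fk_shift_eq]
  exact (hasFDeriv_E k c z).differentiableAt.fun_mul ((quot_diff k c z hz).restrictScalars ℝ)

lemma Fk_shift_twoDbar (k c z : ℂ) (hz : z - c ∉ Lam) :
    twoDbar (fun w => Fk k (w - c)) z = -k * Fk k (z - c) := by
  have e := congrFun (Fk_shift_eq k c) z
  rw [e, Fk_shift_eq, twoDbar_mul (hasFDeriv_E k c z).differentiableAt
    ((quot_diff k c z hz).restrictScalars ℝ), twoDbar_holo (quot_diff k c z hz)]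
  have : twoDbar (fun w : ℂ => Complex.exp (I / 2 * ((w - c) - conj (w - c)) * k)) z =
      -k * Complex.exp (I / 2 * ((z - c) - conj (z - c)) * k) := by
    unfold twoDbar
    rw [(hasFDeriv_E k c z).fderiv]
    generalize Complex.exp (I / 2 * ((z - c) - conj (z - c)) * k) = E
    simp
    ring_nf
    rw [show I ^ 4 = (I^2)^2 by ring, I_sq]
    ring
  rw [this]
  ring

lemma Fk_bound (k : ℂ) : ∃ M : ℝ, 0 ≤ M ∧ ∀ s : ℂ, ‖s‖ ≤ 1/2 → s ≠ 0 → ‖Fk k s‖ * ‖s‖ ≤ M := by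
  have hc : Continuous (fun s : ℂ =>
      Complex.exp (Complex.I / 2 * (s - conj s) * k) * θf (s - zpt k)) := by
    have := theta_diff.continuous
    have h2 : Continuous (fun s : ℂ => conj s) := Complex.continuous_conj
    fun_prop
  obtain ⟨N, hN⟩ := (isCompact_closedBall (0 : ℂ) (1/2)).exists_bound_of_continuousOn hc.continuousOn
  set A := Real.exp (-(Real.pi * (Real.sqrt 3 / 8))) with hA
  have hA0 : 0 < A := Real.exp_pos _
  have hN0 : 0 ≤ N := (norm_nonneg _).trans (hN 0 (by simp))
  refine ⟨N / (A / 2), by positivity, ?_⟩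
  intro s hs hs0
  have h1 := theta_lower s ((Complex.abs_im_le_norm s).trans hs)
  have h2 := sin_lower s hs
  have hn := hN s (by simpa using hs)
  have hs1 : 0 < ‖s‖ := norm_pos_iff.mpr hs0
  have h3 : A / 2 * ‖s‖ ≤ ‖θf s‖ := by
    rw [← hA] at h1
    nlinarith
  have h4 : 0 < ‖θf s‖ := lt_of_lt_of_le (by positivity) h3
  unfold Fk
  rw [norm_div, div_mul_eq_mul_div, div_le_div_iff₀ h4 (by positivity)]
  calc _ = ‖Complex.exp (Complex.I / 2 * (s - conj s) * k) * θf (s - zpt k)‖ * (A / 2 * ‖s‖) := by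
        ring
    _ ≤ N * ‖θf s‖ := by gcongr


/-- multiplying an eigenfunction of D(α) that vanishes at z(k'') by
F_{k'}(· − z(k'')) shifts the eigenvalue from −k to −(k+k'), preserves the twisted
boundary condition off the translated lattice, and stays bounded near the singularities. -/
theorem stmt13 (U : ℂ → ℂ) (hUpot : IsPotential U) (α k k' k'' p : ℂ)
    (u : ℂ → ℂ × ℂ) (hu : ContDiff ℝ (⊤ : ℕ∞) u)
    (hubc : ∀ γ ∈ Lam, ∀ z : ℂ,
      u (z + γ) = Complex.exp (Complex.I * (pairing p γ : ℂ)) •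
        (Complex.exp (-Complex.I * (pairing γ Kpt : ℂ)) * (u z).1,
         Complex.exp (Complex.I * (pairing γ Kpt : ℂ)) * (u z).2))
    (hueq : ∀ z : ℂ, Dop U α u z + k • u z = 0)
    (huz : u (zpt k'') = 0)
    (S : Set ℂ) (hS : S = {w : ℂ | ∃ γ ∈ Lam, w = zpt k'' + γ})
    (v : ℂ → ℂ × ℂ) (hv : ∀ z : ℂ, v z = Fk k' (z - zpt k'') • u z) :
    (∀ z : ℂ, z ∉ S → Dop U α v z + (k + k') • v z = 0) ∧
    (∀ γ ∈ Lam, ∀ z : ℂ, z ∉ S →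
      v (z + γ) = Complex.exp (Complex.I * (pairing p γ : ℂ)) •
        (Complex.exp (-Complex.I * (pairing γ Kpt : ℂ)) * (v z).1,
         Complex.exp (Complex.I * (pairing γ Kpt : ℂ)) * (v z).2)) ∧
    (∀ w ∈ S, ∃ C : ℝ, ∀ z ∈ Metric.ball w (1/2) \ {w}, ‖v z‖ ≤ C) := by
  have hud : Differentiable ℝ u := hu.differentiable (by simp)
  have hu1 : Differentiable ℝ (fun w => (u w).1) := fun x => (hud x).fst
  have hu2 : Differentiable ℝ (fun w => (u w).2) := fun x => (hud x).snd
  have hvf : v = fun z => Fk k' (z - zpt k'') • u z := funext hv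
  refine ⟨?_, ?_, ?_⟩
  · intro z hz
    have hz' : z - zpt k'' ∉ Lam := by
      intro h
      apply hz
      rw [hS]
      exact ⟨_, h, by ring⟩
    have e := hueq z
    have e1 := congrArg Prod.fst e
    have e2 := congrArg Prod.snd e
    simp only [Dop, Prod.fst_add, Prod.snd_add, Prod.smul_fst, Prod.smul_snd, Prod.fst_zero,
      Prod.snd_zero, smul_eq_mul] at e1 e2
    have hF := Fk_shift_diff k' (zpt k'') z hz'
    have hD := Fk_shift_twoDbar k' (zpt k'') z hz'
    have d1 := twoDbar_mul hF (hu1 z)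
    have d2 := twoDbar_mul hF (hu2 z)
    rw [hvf]
    apply Prod.ext
    · simp only [Dop, Prod.fst_add, Prod.smul_fst, Prod.smul_snd, Prod.fst_zero, smul_eq_mul]
      rw [d1, hD]
      linear_combination Fk k' (z - zpt k'') * e1
    · simp only [Dop, Prod.snd_add, Prod.smul_fst, Prod.smul_snd, Prod.snd_zero, smul_eq_mul]
      rw [d2, hD]
      linear_combination Fk k' (z - zpt k'') * e2
  · intro γ hγ z _
    rw [hv, hv, hubc γ hγ z, show z + γ - zpt k'' = z - zpt k'' + γ by ring, Fk_per k' hγ]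
    apply Prod.ext
    · simp only [Prod.smul_fst, smul_eq_mul]; ring
    · simp only [Prod.smul_snd, smul_eq_mul]; ring
  · intro w hw
    rw [hS] at hw
    obtain ⟨γ, hγ, rfl⟩ := hw
    set w := zpt k'' + γ with hw
    have huw : u w = 0 := by
      rw [hw, hubc γ hγ, huz]; simp
    have hcd : Continuous (fderiv ℝ u) := hu.continuous_fderiv (by simp)
    obtain ⟨L, hL⟩ :=
      (isCompact_closedBall w (1/2)).exists_bound_of_continuousOn hcd.continuousOn
    obtain ⟨M, hM0, hM⟩ := Fk_bound k'
    have hL0 : 0 ≤ L := (norm_nonneg _).trans (hL w (by simp))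
    refine ⟨M * L, ?_⟩
    rintro z ⟨hz, hzw⟩
    have hzb : ‖z - w‖ ≤ 1/2 := by
      rw [Metric.mem_ball, dist_eq_norm] at hz; exact hz.le
    have hz0 : z - w ≠ 0 := sub_ne_zero.mpr hzw
    have hlip := (convex_closedBall w (1/2)).norm_image_sub_le_of_norm_fderiv_le (𝕜 := ℝ)
      (fun x _ => hud x) hL (Metric.mem_closedBall_self (by norm_num))
      (Metric.ball_subset_closedBall hz)
    rw [huw, sub_zero] at hlip
    rw [hv, norm_smul, show z - zpt k'' = (z - w) + γ by rw [hw]; ring, Fk_per k' hγ]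
    calc ‖Fk k' (z - w)‖ * ‖u z‖ ≤ ‖Fk k' (z - w)‖ * (L * ‖z - w‖) := by gcongr
      _ = (‖Fk k' (z - w)‖ * ‖z - w‖) * L := by ring
      _ ≤ M * L := by gcongr; exact hM _ hzb hz0
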